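/- (Convergence of randomized SGD with constant step sizes.) Let 𝓛 : ℝ^d → ℝ be differentiable with M-Lipschitz gradient (M > 0) and bounded below with infimum 𝓛*. Fix α ∈ (0, 1), γ > 0, K > 0, L > 0, T ∈ ℕ, and set the constant step size η = min{(1−α)/M, 1/√T}. Let θ_1, …, θ_{T+1} and ĝ_1, …, ĝ_T satisfy θ_{t+1} = θ_t − η ĝ_t, and assume for every t = 1, …, T that ‖ĝ_t − ∇𝓛(θ_t)‖ ≤ α‖∇𝓛(θ_t)‖ and ‖∇𝓛(θ_t)‖ ≤ 2 L e^{2γK}. Then, with C = α M L² e^{4γK} and uniform-style weights p_Z(t) = (2(1−α)η − M η²)/(T(2(1−α)η − M η²)) = 1/T, the weighted average satisfies (1/T) Σ_{t=1}^T ‖∇𝓛(θ_t)‖² < 2M(𝓛(θ_1) − 𝓛*) / ((1−α)² T) + (2(𝓛(θ_1) − 𝓛*) + 12 C) / ((1−α) √T). -/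

import Mathlib

open MeasureTheory

lemma descent_aux {d : ℕ} (M : ℝ)
    (f : EuclideanSpace ℝ (Fin d) → ℝ)
    (f' : EuclideanSpace ℝ (Fin d) → EuclideanSpace ℝ (Fin d))
    (hgrad : ∀ θ, HasGradientAt f (f' θ) θ)
    (hsmooth : ∀ θ₁ θ₂, ‖f' θ₁ - f' θ₂‖ ≤ M * ‖θ₁ - θ₂‖)
    (x v : EuclideanSpace ℝ (Fin d)) :
    f (x + v) ≤ f x + inner ℝ (f' x) v + M / 2 * ‖v‖ ^ 2 := by
  have hd : ∀ s : ℝ, HasDerivAt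
      (fun s : ℝ => f (x + s • v) - s * inner ℝ (f' x) v - M / 2 * ‖v‖ ^ 2 * s ^ 2)
      (inner ℝ (f' (x + s • v)) v - inner ℝ (f' x) v - M * ‖v‖ ^ 2 * s) s := by
    intro s
    have h1 : HasDerivAt (fun s : ℝ => x + s • v) v s := by
      simpa using ((hasDerivAt_id s).smul_const v).const_add x
    have h2 := (hgrad (x + s • v)).hasFDerivAt.comp_hasDerivAt s h1
    have h3 : HasDerivAt (fun s : ℝ => f (x + s • v)) (inner ℝ (f' (x + s • v)) v) s := by
      simpa [Function.comp_def] using h2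
    have h4 := (hasDerivAt_id s).mul_const (inner ℝ (f' x) v)
    have h5 := ((hasDerivAt_id s).pow 2).const_mul (M / 2 * ‖v‖ ^ 2)
    refine ((h3.sub h4).sub h5).congr_deriv ?_
    simp
    ring
  have hanti : AntitoneOn
      (fun s : ℝ => f (x + s • v) - s * inner ℝ (f' x) v - M / 2 * ‖v‖ ^ 2 * s ^ 2)
      (Set.Icc 0 1) := by
    apply antitoneOn_of_deriv_nonpos (convex_Icc 0 1)
    · exact fun s _ => (hd s).continuousAt.continuousWithinAt
    · exact fun s _ => (hd s).differentiableAt.differentiableWithinAt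
    · intro s hs
      rw [interior_Icc] at hs
      rw [(hd s).deriv, ← inner_sub_left]
      have a1 := real_inner_le_norm (f' (x + s • v) - f' x) v
      have a2 := hsmooth (x + s • v) x
      rw [add_sub_cancel_left, norm_smul, Real.norm_of_nonneg hs.1.le] at a2
      have a3 := mul_le_mul_of_nonneg_right a2 (norm_nonneg v)
      nlinarith
  have := hanti (Set.left_mem_Icc.2 zero_le_one) (Set.right_mem_Icc.2 zero_le_one) zero_le_one
  simp at this
  linarith

/-- Corollary 1 (convergence of randomized SGD with constant step sizes
`η = min{(1−α)/M, 1/√T}`): with `C = α M L² e^{4γK}`, the uniform average of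
squared gradient norms satisfies
`(1/T) ∑_t ‖∇𝓛(θ_t)‖² < 2M(𝓛(θ₁)−𝓛*)/((1−α)²T) + (2(𝓛(θ₁)−𝓛*)+12C)/((1−α)√T)`. -/
theorem randomized_sgd_constant_step_convergence
    {d : ℕ} (M α γ K L : ℝ) (hM : 0 < M) (hα : α ∈ Set.Ioo (0 : ℝ) 1)
    (hγ : 0 < γ) (hK : 0 < K) (hL : 0 < L)
    (𝓛 : EuclideanSpace ℝ (Fin d) → ℝ)
    (𝓛' : EuclideanSpace ℝ (Fin d) → EuclideanSpace ℝ (Fin d))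
    (hgrad : ∀ θ, HasGradientAt 𝓛 (𝓛' θ) θ)
    (hsmooth : ∀ θ₁ θ₂, ‖𝓛' θ₁ - 𝓛' θ₂‖ ≤ M * ‖θ₁ - θ₂‖)
    (Lstar : ℝ) (hLB : ∀ θ, Lstar ≤ 𝓛 θ)
    (T : ℕ) (hT : 1 ≤ T)
    (η : ℝ) (hη : η = min ((1 - α) / M) (1 / Real.sqrt T))
    (θ : ℕ → EuclideanSpace ℝ (Fin d)) (ghat : ℕ → EuclideanSpace ℝ (Fin d))
    (hupd : ∀ t ∈ Finset.Icc 1 T, θ (t + 1) = θ t - η • ghat t)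
    (hacc : ∀ t ∈ Finset.Icc 1 T, ‖ghat t - 𝓛' (θ t)‖ ≤ α * ‖𝓛' (θ t)‖)
    (hgb : ∀ t ∈ Finset.Icc 1 T, ‖𝓛' (θ t)‖ ≤ 2 * L * Real.exp (2 * γ * K)) :
    (1 / (T : ℝ)) * ∑ t ∈ Finset.Icc 1 T, ‖𝓛' (θ t)‖ ^ 2
      < 2 * M * (𝓛 (θ 1) - Lstar) / ((1 - α) ^ 2 * T)
        + (2 * (𝓛 (θ 1) - Lstar) + 12 * (α * M * L ^ 2 * Real.exp (4 * γ * K)))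
          / ((1 - α) * Real.sqrt T) := by
  obtain ⟨h0, h1⟩ := hα
  have ha : 0 < 1 - α := by linarith
  have hTpos : (0 : ℝ) < T := by exact_mod_cast hT
  have hsT : 0 < Real.sqrt T := Real.sqrt_pos.2 hTpos
  have hηpos : 0 < η := by rw [hη]; exact lt_min (by positivity) (by positivity)
  have hMη : M * η ≤ 1 - α := by
    have : η ≤ (1 - α) / M := hη ▸ min_le_left _ _
    rw [le_div_iff₀ hM] at this
    linarith
  have hinv : 1 / η ≤ M / (1 - α) + Real.sqrt T := by
    have p1 : 0 < M / (1 - α) := by positivity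
    rcases min_choice ((1 - α) / M) (1 / Real.sqrt T) with h | h
    · rw [hη, h, one_div_div]; linarith
    · rw [hη, h, one_div_one_div]; linarith
  have step : ∀ t ∈ Finset.Icc 1 T,
      η * (1 - α) / 2 * ‖𝓛' (θ t)‖ ^ 2 ≤ 𝓛 (θ t) - 𝓛 (θ (t + 1)) := by
    intro t ht
    have hde := descent_aux M 𝓛 𝓛' hgrad hsmooth (θ t) (-(η • ghat t))
    rw [← sub_eq_add_neg, ← hupd t ht, norm_neg, norm_smul, Real.norm_of_nonneg hηpos.le,
      inner_neg_right, inner_smul_right] at hde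
    obtain ⟨δ, hδ⟩ : ∃ δ, ghat t = 𝓛' (θ t) + δ := ⟨ghat t - 𝓛' (θ t), by abel⟩
    have hb := hacc t ht
    rw [hδ, add_sub_cancel_left] at hb
    rw [hδ, mul_pow, norm_add_sq_real, inner_add_right, real_inner_self_eq_norm_sq] at hde
    have hi : -(α * ‖𝓛' (θ t)‖ ^ 2) ≤ inner ℝ (𝓛' (θ t)) δ := by
      have b1 := (abs_le.1 (abs_real_inner_le_norm (𝓛' (θ t)) δ)).1
      have b2 := mul_le_mul_of_nonneg_left hb (norm_nonneg (𝓛' (θ t)))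
      nlinarith
    have hd2 : ‖δ‖ ^ 2 ≤ α ^ 2 * ‖𝓛' (θ t)‖ ^ 2 := by
      rw [← mul_pow]
      exact pow_le_pow_left₀ (norm_nonneg _) hb 2
    generalize inner ℝ (𝓛' (θ t)) δ = I at *
    have hG : 0 ≤ ‖𝓛' (θ t)‖ ^ 2 := by positivity
    generalize ‖𝓛' (θ t)‖ ^ 2 = G at *
    generalize ‖δ‖ ^ 2 = D at *
    have c1 : 0 ≤ η * (1 - M * η) * (I + α * G) :=
      mul_nonneg (mul_nonneg hηpos.le (by linarith)) (by linarith)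
    have c2 : 0 ≤ M * η ^ 2 / 2 * (α ^ 2 * G - D) :=
      mul_nonneg (by positivity) (by linarith)
    have c3 : 0 ≤ η * (1 - α) / 2 * G * (1 - M * η * (1 - α)) :=
      mul_nonneg (by positivity) (by nlinarith)
    nlinarith
  have hsum := Finset.sum_le_sum step
  have htel : ∑ t ∈ Finset.Icc 1 T, (𝓛 (θ t) - 𝓛 (θ (t + 1))) = 𝓛 (θ 1) - 𝓛 (θ (T + 1)) := by
    clear hsum step hinv hMη hηpos hsT hTpos hgb hacc hupd hη
    induction T, hT using Nat.le_induction with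
    | base => simp
    | succ n hn ih => rw [Finset.sum_Icc_succ_top (by omega), ih]; ring
  rw [htel, ← Finset.mul_sum] at hsum
  have hΔ := hLB (θ (T + 1))
  have hΔ1 := hLB (θ 1)
  generalize ∑ t ∈ Finset.Icc 1 T, ‖𝓛' (θ t)‖ ^ 2 = S at *
  have hC : 0 < 12 * (α * M * L ^ 2 * Real.exp (4 * γ * K)) / ((1 - α) * Real.sqrt T) := by
    positivity
  have hS : S ≤ 2 * (𝓛 (θ 1) - Lstar) / (1 - α) * (1 / η) := by
    rw [div_mul_div_comm, mul_one, le_div_iff₀ (by positivity)]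
    linarith
  have hS2 : S ≤ 2 * (𝓛 (θ 1) - Lstar) / (1 - α) * (M / (1 - α) + Real.sqrt T) :=
    hS.trans (mul_le_mul_of_nonneg_left hinv
      (div_nonneg (by linarith) ha.le))
  have hfin : 1 / (T : ℝ) * S ≤ 1 / (T : ℝ) *
      (2 * (𝓛 (θ 1) - Lstar) / (1 - α) * (M / (1 - α) + Real.sqrt T)) :=
    mul_le_mul_of_nonneg_left hS2 (by positivity)
  have hq : Real.sqrt T ^ 2 = T := Real.sq_sqrt hTpos.le
  have heq : 1 / (T : ℝ) *
      (2 * (𝓛 (θ 1) - Lstar) / (1 - α) * (M / (1 - α) + Real.sqrt T))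
      = 2 * M * (𝓛 (θ 1) - Lstar) / ((1 - α) ^ 2 * T)
        + 2 * (𝓛 (θ 1) - Lstar) / ((1 - α) * Real.sqrt T) := by
    generalize Real.sqrt T = q at *
    rw [← hq]
    field_simp
  rw [add_div]
  linarith
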